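/- arXiv:1803.04146 — 2 statements merged into one kernel-verified Lean document; each statement's English description precedes it below -/
import Mathlib

section
/- Let ℓ ⊆ ℂ⁴ be a 2-dimensional ℂ-linear subspace and let P, Q ∈ ℂ⁴ be vectors such that ℂ⁴ is the direct sum of ℓ and the span of {P, Q}. Then the set of homogeneous cubic forms F over ℂ that vanish identically on ℓ and are singular at both P and Q is a ℂ-linear subspace of dimension 8 of the space of homogeneous cubic forms. -/
open MvPolynomial

namespace MvPolynomial

section LinearSubstitution

variable {σ R : Type*} [Fintype σ] [DecidableEq σ] [CommRing R]

/-- The algebra endomorphism of `MvPolynomial σ R` that precomposes polynomial functions with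
the linear map `f`. -/
noncomputable def linearSubst (f : (σ → R) →ₗ[R] (σ → R)) :
    MvPolynomial σ R →ₐ[R] MvPolynomial σ R :=
  aeval fun i => ∑ j, C (f (Pi.single j 1) i) * X j

lemma eval_linearSubst (f : (σ → R) →ₗ[R] (σ → R)) (w : σ → R) (F : MvPolynomial σ R) :
    eval w (linearSubst f F) = eval (f w) F := by
  have hf : (fun i => eval w (∑ j, C (f (Pi.single j 1) i) * X j)) = f w := by
    funext i
    conv_rhs => rw [pi_eq_sum_univ' w]
    simp [map_sum, Finset.sum_apply, mul_comm]
  rw [← hf]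
  induction F using MvPolynomial.induction_on with
  | C a => simp [linearSubst]
  | add p q hp hq => simp [hp, hq]
  | mul_X p i hp => rw [map_mul, map_mul, map_mul, hp, linearSubst, aeval_X, eval_X]

lemma IsHomogeneous.linearSubst {F : MvPolynomial σ R} {n : ℕ} (hF : F.IsHomogeneous n)
    (f : (σ → R) →ₗ[R] (σ → R)) : (MvPolynomial.linearSubst f F).IsHomogeneous n := by
  have h := hF.aeval (n := 1) (fun i => ∑ j, C (f (Pi.single j 1) i) * X j) fun i =>
    IsHomogeneous.sum _ _ _ fun j _ => isHomogeneous_C_mul_X _ _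
  rwa [one_mul] at h

lemma eval_pderiv_linearSubst (f : (σ → R) →ₗ[R] (σ → R)) (w : σ → R) (j : σ)
    (F : MvPolynomial σ R) :
    eval w (pderiv j (linearSubst f F)) =
      ∑ i, f (Pi.single j 1) i * eval (f w) (pderiv i F) := by
  induction F using MvPolynomial.induction_on with
  | C a => simp [linearSubst]
  | add p q hp hq => simp [hp, hq, mul_add, Finset.sum_add_distrib]
  | mul_X p k hp =>
    have hX : pderiv j (linearSubst f (X k)) = C (f (Pi.single j 1) k) := by
      simp [linearSubst, pderiv_X, Pi.single_apply]
    simp only [map_mul, pderiv_mul, hX, map_add, hp, eval_linearSubst, eval_X, eval_C,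
      pderiv_X, mul_add, Finset.sum_add_distrib, Finset.sum_mul]
    congr 1
    · exact Finset.sum_congr rfl fun i _ => by ring
    · rw [Finset.sum_eq_single k]
      · simp [mul_comm]
      · intro i _ hi
        simp [hi.symm]
      · simp

/-- Linear substitution along a linear automorphism, as an automorphism of the module of
polynomials. -/
noncomputable def linearSubstEquiv [IsDomain R] [Infinite R] (e : (σ → R) ≃ₗ[R] (σ → R)) :
    MvPolynomial σ R ≃ₗ[R] MvPolynomial σ R :=
  LinearEquiv.ofLinearMap (linearSubst (e : (σ → R) →ₗ[R] (σ → R))).toLinearMap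
    (linearSubst (e.symm : (σ → R) →ₗ[R] (σ → R))).toLinearMap
    (LinearMap.ext fun F => funext fun w => by simp [eval_linearSubst])
    (LinearMap.ext fun F => funext fun w => by simp [eval_linearSubst])

end LinearSubstitution

lemma finrank_restrictSupport {σ R : Type*} [CommRing R] [Nontrivial R] (s : Set (σ →₀ ℕ)) :
    Module.finrank R (restrictSupport R s) = Nat.card s :=
  Module.finrank_eq_nat_card_basis (basisRestrictSupport R s)

/-- A polynomial vanishes on a coordinate subspace iff it has no monomials in the coordinates
of that subspace alone. -/
lemma forall_eval_eq_zero_iff_coeff {σ R : Type*} [Fintype σ] [CommRing R] [IsDomain R]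
    [Infinite R] (s : Set σ) (F : MvPolynomial σ R) :
    (∀ v : σ → R, (∀ i ∉ s, v i = 0) → eval v F = 0) ↔
      ∀ d : σ →₀ ℕ, (∀ i ∉ s, d i = 0) → coeff d F = 0 := by
  classical
  have hprod : ∀ v : σ → R, (∀ i ∉ s, v i = 0) → ∀ d : σ →₀ ℕ, ¬ (∀ i ∉ s, d i = 0) →
      ∏ i, v i ^ d i = 0 := by
    intro v hv d hd
    push Not at hd
    obtain ⟨i, hi, hdi⟩ := hd
    exact Finset.prod_eq_zero (Finset.mem_univ i) (by rw [hv i hi, zero_pow hdi])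
  constructor
  · intro h d hd
    let G : MvPolynomial σ R :=
      ∑ d ∈ F.support with ∀ i ∉ s, d i = 0, monomial d (coeff d F)
    have hG : G = 0 := by
      refine funext fun v => ?_
      rw [map_zero, ← h (s.indicator v) (fun i hi => Set.indicator_of_notMem hi v),
        eval_eq' _ F, map_sum, Finset.sum_filter]
      refine Finset.sum_congr rfl fun d _ => ?_
      split_ifs with hd
      · rw [eval_monomial, Finsupp.prod_fintype _ _ (by simp)]
        congr 1
        refine Finset.prod_congr rfl fun i _ => ?_
        by_cases hi : i ∈ s
        · rw [Set.indicator_of_mem hi]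
        · rw [hd i hi, pow_zero, pow_zero]
      · rw [hprod _ (fun i hi => Set.indicator_of_notMem hi v) d hd, mul_zero]
    have hc : coeff d G = coeff d F := by
      simp only [G, coeff_sum, coeff_monomial, Finset.sum_ite_eq', Finset.mem_filter,
        mem_support_iff]
      split_ifs with h'
      · rfl
      · by_contra hne
        exact h' ⟨fun h0 => hne h0.symm, hd⟩
    rw [← hc, hG, coeff_zero]
  · intro h v hv
    rw [eval_eq']
    refine Finset.sum_eq_zero fun d _ => ?_
    by_cases hd : ∀ i ∉ s, d i = 0
    · rw [h d hd, zero_mul]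
    · rw [hprod v hv d hd, mul_zero]

lemma IsHomogeneous.eval_single_one {σ R : Type*} [Fintype σ] [DecidableEq σ] [CommRing R]
    {F : MvPolynomial σ R} {n : ℕ} (hF : F.IsHomogeneous n) (k : σ) :
    eval (Pi.single k 1) F = coeff (Finsupp.single k n) F := by
  rw [eval_eq', Finset.sum_eq_single (Finsupp.single k n)]
  · rw [Finset.prod_eq_one, mul_one]
    intro i _
    by_cases hi : i = k
    · subst hi; simp
    · simp [Ne.symm hi]
  · intro d hd hne
    suffices h : ∃ i, i ≠ k ∧ d i ≠ 0 by
      obtain ⟨i, hi, hdi⟩ := h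
      rw [Finset.prod_eq_zero (Finset.mem_univ i) (by rw [Pi.single_eq_of_ne hi, zero_pow hdi]),
        mul_zero]
    by_contra! h
    refine hne ?_
    have hd' : d.degree = n := by
      rw [Finsupp.degree_eq_weight_one]
      exact hF (mem_support_iff.1 hd)
    have hk : d.degree = d k := by
      rw [Finsupp.degree_eq_sum]
      exact Finset.sum_eq_single k (fun i _ hi => h i hi) (by simp)
    ext i
    by_cases hi : i = k
    · subst hi; simp [← hd', hk]
    · rw [h i hi, Finsupp.single_eq_of_ne hi]
  · intro h
    rw [notMem_support_iff.1 h, zero_mul]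

/-- A cubic form is singular at the `k`-th coordinate point iff the exponent of the `k`-th
variable is at most one in each of its monomials. -/
lemma IsHomogeneous.singular_single_one_iff {σ : Type*} [Fintype σ] [DecidableEq σ]
    {F : MvPolynomial σ ℂ} (hF : F.IsHomogeneous 3) (k : σ) :
    (∀ i, eval (Pi.single k 1) (pderiv i F) = 0) ↔ ∀ d ∈ F.support, d k ≤ 1 := by
  have key : ∀ i, eval (Pi.single k 1) (pderiv i F) = 0 ↔
      coeff (Finsupp.single k 2 + Finsupp.single i 1) F = 0 := by
    intro i
    rw [hF.pderiv.eval_single_one k, coeff_pderiv, mul_eq_zero, or_iff_left]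
    exact Nat.cast_add_one_ne_zero _
  simp only [key]
  constructor
  · intro h d hd
    by_contra! hk
    obtain ⟨c, rfl⟩ : ∃ c, d = Finsupp.single k 2 + c :=
      exists_add_of_le (Finsupp.single_le_iff.2 hk)
    have hdeg : (Finsupp.single k 2 + c).degree = 3 := by
      rw [Finsupp.degree_eq_weight_one]
      exact hF (mem_support_iff.1 hd)
    have hc : c.degree = 1 := by
      rw [map_add, Finsupp.degree_single] at hdeg
      omega
    obtain ⟨i, rfl⟩ : c ∈ Set.range fun i : σ => Finsupp.single i 1 := by
      rw [Finsupp.range_single_one]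
      exact hc
    exact mem_support_iff.1 hd (h i)
  · intro h i
    by_contra hne
    have := h _ (mem_support_iff.2 hne)
    rw [Finsupp.add_apply, Finsupp.single_eq_same] at this
    omega

end MvPolynomial

/-- The number of exponent vectors of degree `n` in `k` variables satisfying a predicate. -/
lemma natCard_finsupp_degree_eq {k : ℕ} (n : ℕ) (p : (Fin k → ℕ) → Prop) [DecidablePred p] :
    Nat.card {d : Fin k →₀ ℕ | d.degree = n ∧ p d} =
      ((Finset.Nat.antidiagonalTuple k n).filter p).card := by
  rw [← Nat.card_eq_finsetCard]
  refine Nat.card_congr (Finsupp.equivFunOnFinite.subtypeEquiv fun d => ?_)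
  simp only [Set.mem_ofPred_eq, Finset.mem_filter, Finset.Nat.mem_antidiagonalTuple,
    Finsupp.degree_eq_sum]
  rfl

/-- A line and two points spanning `K⁴` are, up to a linear automorphism, the line through the
first two coordinate points and the last two coordinate points. -/
lemma exists_linearEquiv_adapted {K : Type*} [Field K] (ℓ : Submodule K (Fin 4 → K))
    (hℓ : Module.finrank K ℓ = 2) (P Q : Fin 4 → K)
    (hPQ : IsCompl ℓ (Submodule.span K {P, Q})) :
    ∃ e : (Fin 4 → K) ≃ₗ[K] (Fin 4 → K),
      (∀ w, e w ∈ ℓ ↔ ∀ i ∉ ({0, 1} : Set (Fin 4)), w i = 0) ∧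
      e (Pi.single 2 1) = P ∧ e (Pi.single 3 1) = Q := by
  let c := Module.finBasisOfFinrankEq K ℓ hℓ
  let v : Fin 4 → Fin 4 → K := ![c 0, c 1, P, Q]
  have hc : Submodule.span K {(c 0 : Fin 4 → K), (c 1 : Fin 4 → K)} = ℓ := by
    have := congrArg (Submodule.map ℓ.subtype) c.span_eq
    rw [Submodule.map_span, Submodule.map_subtype_top, ← Set.range_comp] at this
    refine Eq.trans (congrArg _ ?_) this
    ext x
    simp [Fin.exists_fin_two, eq_comm]
  have hspan : ⊤ ≤ Submodule.span K (Set.range v) := by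
    rw [← hPQ.sup_eq_top, ← hc, ← Submodule.span_union]
    refine Submodule.span_mono ?_
    rintro x ((rfl | rfl) | (rfl | rfl))
    exacts [⟨0, rfl⟩, ⟨1, rfl⟩, ⟨2, rfl⟩, ⟨3, rfl⟩]
  let b := basisOfTopLeSpanOfCardEqFinrank v hspan (by simp)
  have hb : ∀ w, b.equivFun.symm w =
      (w 0 • (c 0 : Fin 4 → K) + w 1 • (c 1 : Fin 4 → K)) + (w 2 • P + w 3 • Q) := by
    intro w
    rw [Module.Basis.equivFun_symm_apply, Fin.sum_univ_four]
    simp [b, v, add_assoc]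
  have hmem : ∀ x y : K, x • (c 0 : Fin 4 → K) + y • (c 1 : Fin 4 → K) ∈ ℓ := fun x y =>
    ℓ.add_mem (ℓ.smul_mem _ (c 0).2) (ℓ.smul_mem _ (c 1).2)
  refine ⟨b.equivFun.symm, fun w => ⟨fun hw => ?_, fun hw => ?_⟩, ?_, ?_⟩
  · obtain ⟨x, y, hxy⟩ := Submodule.mem_span_pair.1 (hc.symm ▸ hw)
    have : w = ![x, y, 0, 0] := by
      apply b.equivFun.symm.injective
      rw [← hxy, hb]
      simp
    intro i hi
    rw [this]
    fin_cases i <;> simp at hi ⊢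
  · rw [hb, hw 2 (by simp), hw 3 (by simp)]
    simpa using hmem _ _
  · simp [hb]
  · simp [hb]

/-- For a 2-dimensional subspace `ℓ ⊆ ℂ⁴` and points `P, Q` with `ℂ⁴ = ℓ ⊕ span{P, Q}`,
the homogeneous cubic forms vanishing identically on `ℓ` and singular at both `P` and `Q`
form an 8-dimensional linear subspace of the 20-dimensional space of homogeneous cubic
forms. -/
theorem forms_vanishing_on_line_singular_at_two_points (ℓ : Submodule ℂ (Fin 4 → ℂ))
    (hℓ : Module.finrank ℂ ℓ = 2) (P Q : Fin 4 → ℂ)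
    (hPQ : IsCompl ℓ (Submodule.span ℂ {P, Q})) :
    ∃ L : Submodule ℂ (MvPolynomial (Fin 4) ℂ),
      (L : Set (MvPolynomial (Fin 4) ℂ)) =
        {F | F.IsHomogeneous 3 ∧ (∀ v ∈ ℓ, eval v F = 0) ∧
          (∀ i : Fin 4, eval P (pderiv i F) = 0) ∧
          ∀ i : Fin 4, eval Q (pderiv i F) = 0} ∧
      Module.finrank ℂ L = 8 ∧
      Module.finrank ℂ (homogeneousSubmodule (Fin 4) ℂ 3) = 20 := by
  classical
  obtain ⟨e, heℓ, heP, heQ⟩ := exists_linearEquiv_adapted ℓ hℓ P Q hPQ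
  let p : (Fin 4 → ℕ) → Prop := fun d => ¬ (d 2 = 0 ∧ d 3 = 0) ∧ d 2 ≤ 1 ∧ d 3 ≤ 1
  let S : Set (Fin 4 →₀ ℕ) := {d | d.degree = 3 ∧ p d}
  have hS : ∀ F : MvPolynomial (Fin 4) ℂ, F ∈ restrictSupport ℂ S ↔
      F.IsHomogeneous 3 ∧
        (∀ v : Fin 4 → ℂ, (∀ i ∉ ({0, 1} : Set (Fin 4)), v i = 0) → eval v F = 0) ∧
        (∀ i, eval (Pi.single 2 1) (pderiv i F) = 0) ∧
        ∀ i, eval (Pi.single 3 1) (pderiv i F) = 0 := by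
    intro F
    have hhom : F.IsHomogeneous 3 ↔ ∀ d ∈ F.support, d.degree = 3 := by
      rw [← mem_homogeneousSubmodule, homogeneousSubmodule_eq_finsupp_supported]
      rfl
    have hdis : ∀ d : Fin 4 →₀ ℕ, (∀ i ∉ ({0, 1} : Set (Fin 4)), d i = 0) ↔
        d 2 = 0 ∧ d 3 = 0 := by
      simp [Fin.forall_fin_succ]
    constructor
    · intro hF
      have h3 : F.IsHomogeneous 3 := hhom.2 fun d hd => (hF hd).1
      rw [forall_eval_eq_zero_iff_coeff, h3.singular_single_one_iff,
        h3.singular_single_one_iff]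
      refine ⟨h3, fun d hd => ?_, fun d hd => (hF hd).2.2.1, fun d hd => (hF hd).2.2.2⟩
      by_contra hne
      exact (hF (mem_support_iff.2 hne)).2.1 ((hdis d).1 hd)
    · rintro ⟨h3, hv, h⟩
      rw [forall_eval_eq_zero_iff_coeff] at hv
      rw [h3.singular_single_one_iff, h3.singular_single_one_iff] at h
      exact fun d hd => ⟨hhom.1 h3 d hd,
        fun h0 => mem_support_iff.1 hd (hv d ((hdis d).2 h0)), h.1 d hd, h.2 d hd⟩
  let φ := linearSubstEquiv e
  refine ⟨(restrictSupport ℂ S).map (φ.symm : _ →ₗ[ℂ] _), ?_, ?_, ?_⟩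
  · have hsing : ∀ (f : (Fin 4 → ℂ) →ₗ[ℂ] (Fin 4 → ℂ)) (w : Fin 4 → ℂ)
        (F : MvPolynomial (Fin 4) ℂ), (∀ i, eval (f w) (pderiv i F) = 0) →
        ∀ j, eval w (pderiv j (linearSubst f F)) = 0 := fun f w F h j => by
      simp [eval_pderiv_linearSubst, h]
    have hφ : ∀ F, φ F = linearSubst (e : (Fin 4 → ℂ) →ₗ[ℂ] (Fin 4 → ℂ)) F := fun _ => rfl
    have hφ' : ∀ F, linearSubst (e.symm : (Fin 4 → ℂ) →ₗ[ℂ] (Fin 4 → ℂ)) (φ F) = F :=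
      φ.symm_apply_apply
    have hsing_iff : ∀ (w : Fin 4 → ℂ) (F : MvPolynomial (Fin 4) ℂ),
        (∀ j, eval w (pderiv j (φ F)) = 0) ↔ ∀ i, eval (e w) (pderiv i F) = 0 :=
      fun w F => ⟨fun h => by
        have := hsing (e.symm : (Fin 4 → ℂ) →ₗ[ℂ] (Fin 4 → ℂ)) (e w) (φ F) (by simpa using h)
        rwa [hφ'] at this, hsing (e : (Fin 4 → ℂ) →ₗ[ℂ] (Fin 4 → ℂ)) w F⟩
    ext F
    rw [SetLike.mem_coe, Submodule.mem_map_equiv, LinearEquiv.symm_symm, hS, Set.mem_ofPred_eq,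
      hsing_iff, hsing_iff, heP, heQ]
    refine and_congr ⟨fun h => hφ' F ▸ h.linearSubst _, fun h => h.linearSubst _⟩
      (and_congr_left fun _ => ⟨fun h v hv => ?_, fun h w hw => ?_⟩)
    · have := h (e.symm v) ((heℓ _).1 (by simpa using hv))
      simpa [hφ, eval_linearSubst] using this
    · simpa [hφ, eval_linearSubst] using h (e w) ((heℓ w).2 hw)
  · rw [LinearEquiv.finrank_map_eq, finrank_restrictSupport, natCard_finsupp_degree_eq 3 p]
    decide
  · have h := natCard_finsupp_degree_eq (k := 4) 3 fun _ => True
    simp only [and_true, Finset.filter_true] at h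
    rw [homogeneousSubmodule_eq_finsupp_supported]
    refine (finrank_restrictSupport _).trans (h.trans ?_)
    decide
end

section
/- For every 2-dimensional ℂ-linear subspace ℓ ⊆ ℂ⁴ there exists a smooth homogeneous cubic form F over ℂ that vanishes identically on ℓ. Consequently, the singular forms vanishing on ℓ form a proper algebraic hypersurface Σ_ℓ in the 16-dimensional space Π_ℓ of all cubic forms vanishing on ℓ, and its complement X̃_ℓ = Π_ℓ ∖ Σ_ℓ is nonempty. -/
open MvPolynomial

/-- A linear functional on `ι → R`, written as a linear form in the coordinates. -/
noncomputable def linearForm {ι R : Type*} [Fintype ι] [DecidableEq ι] [CommSemiring R]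
    (φ : (ι → R) →ₗ[R] R) : MvPolynomial ι R :=
  ∑ j, C (φ (Pi.single j 1)) * X j

section LinearForm

variable {ι R : Type*} [Fintype ι] [DecidableEq ι] [CommSemiring R] (φ : (ι → R) →ₗ[R] R)

theorem linearForm_isHomogeneous : (linearForm φ).IsHomogeneous 1 :=
  IsHomogeneous.sum _ _ _ fun j _ => isHomogeneous_C_mul_X _ j

theorem eval_linearForm (v : ι → R) : eval v (linearForm φ) = φ v := by
  conv_rhs => rw [pi_eq_sum_univ' v]
  simp [linearForm, mul_comm]

theorem pderiv_linearForm (i : ι) :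
    pderiv i (linearForm φ) = C (φ (Pi.single i 1)) := by
  simp [linearForm, pderiv_X, Pi.single_apply]

end LinearForm

/-- A basis of `V` indexed by a sum, the first part of which is a basis of `ℓ`: the coordinates
of the second part vanish on `ℓ`. -/
theorem exists_basis_coord_inr_eq_zero {K V : Type*} [Field K] [AddCommGroup V] [Module K V]
    [FiniteDimensional K V] (ℓ : Submodule K V) {m n : ℕ} (hℓ : Module.finrank K ℓ = m)
    (hV : Module.finrank K V = m + n) :
    ∃ b : Module.Basis (Fin m ⊕ Fin n) K V, ∀ v ∈ ℓ, ∀ i, b.coord (Sum.inr i) v = 0 := by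
  obtain ⟨ℓ', h⟩ := ℓ.exists_isCompl
  have hℓ' : Module.finrank K ℓ' = n := by
    have := Submodule.finrank_add_eq_of_isCompl h
    omega
  refine ⟨((Module.finBasisOfFinrankEq K ℓ hℓ).prod (Module.finBasisOfFinrankEq K ℓ' hℓ')).map
    (Submodule.prodEquivOfIsCompl ℓ ℓ' h), fun v hv i => ?_⟩
  simp [(Submodule.projectionOnto_apply_eq_zero_iff h.symm).mpr hv]

/-- For every 2-dimensional subspace `ℓ ⊆ ℂ⁴` there exists a smooth homogeneous cubic
form over `ℂ` vanishing identically on `ℓ`; that is, the space `X̃_ℓ = Π_ℓ ∖ Σ_ℓ` of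
smooth cubic forms vanishing on `ℓ` is nonempty (so the singular forms vanishing on `ℓ`
form a proper hypersurface in the 16-dimensional space `Π_ℓ`). -/
theorem exists_smooth_cubic_form_vanishing_on_line (ℓ : Submodule ℂ (Fin 4 → ℂ))
    (hℓ : Module.finrank ℂ ℓ = 2) :
    ∃ F : MvPolynomial (Fin 4) ℂ, F.IsHomogeneous 3 ∧
      (∀ v : Fin 4 → ℂ, v ≠ 0 → ∃ i : Fin 4, eval v (pderiv i F) ≠ 0) ∧
      ∀ v ∈ ℓ, eval v F = 0 := by
  obtain ⟨b, hb⟩ := exists_basis_coord_inr_eq_zero ℓ (n := 2) hℓ (by simp)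
  -- In the coordinates `x i`, `y i` of `b`, the form is `∑ i, (x i ^ 2 * y i + y i ^ 3)`.
  let x (i : Fin 2) := b.coord (Sum.inl i)
  let y (i : Fin 2) := b.coord (Sum.inr i)
  refine ⟨∑ i, (linearForm (x i) ^ 2 * linearForm (y i) + linearForm (y i) ^ 3), ?_, ?_, ?_⟩
  · exact IsHomogeneous.sum _ _ _ fun i _ =>
      (((linearForm_isHomogeneous _).pow 2).mul (linearForm_isHomogeneous _)).add
        ((linearForm_isHomogeneous _).pow 3)
  · intro v hv
    by_contra! hF
    have hφ : ∑ i, ((2 * x i v * y i v) • x i + (x i v ^ 2 + 3 * y i v ^ 2) • y i) = 0 := by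
      refine (Pi.basisFun ℂ (Fin 4)).ext fun j => ?_
      have := hF j
      simp only [map_sum, map_add, Derivation.leibniz, Derivation.leibniz_pow, pderiv_linearForm,
        smul_eq_mul, nsmul_eq_mul, map_mul, map_pow, eval_linearForm, eval_C, map_natCast] at this
      simp only [Pi.basisFun_apply, LinearMap.sum_apply, LinearMap.add_apply,
        LinearMap.smul_apply, smul_eq_mul, LinearMap.zero_apply]
      rw [← this]
      refine Finset.sum_congr rfl fun i _ => ?_
      push_cast
      ring
    have hx (i : Fin 2) : 2 * x i v * y i v = 0 := by
      simpa [x, y, Finsupp.single_apply, -Fin.sum_univ_two] using LinearMap.congr_fun hφ (b (Sum.inl i))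
    have hy (i : Fin 2) : x i v ^ 2 + 3 * y i v ^ 2 = 0 := by
      simpa [x, y, Finsupp.single_apply, -Fin.sum_univ_two] using LinearMap.congr_fun hφ (b (Sum.inr i))
    have hxy (i : Fin 2) : x i v = 0 ∧ y i v = 0 := by
      have h₁ := hx i
      have h₂ := hy i
      rcases mul_eq_zero.mp h₁ with h | h <;> simp_all
    refine hv (b.forall_coord_eq_zero_iff.mp ?_)
    rintro (i | i)
    exacts [(hxy i).1, (hxy i).2]
  · intro v hv
    simp [eval_linearForm, y, hb v hv, -Module.Basis.coord_apply]
end
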